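/- Let d, s, δ ∈ ℕ with 2δ ≤ s, and l ∈ [d]. The number of edges e ∈ E_{d,s,δ} with level_d(e) = l equals (d+1) · binomial(d, l) · ( binomial(s, l) − (l+1)·binomial(δ, l) ), where level_d({v,w}) := max{level_d(v), level_d(w)}. -/

import Mathlib

/-- Membership in the Steiner-vertex set `V_{d,s,δ}` of the simplified simplex graph. -/
def inSimplifiedV (d s δ : ℕ) (v : Fin (d + 1) → ℕ) : Prop :=
  (∑ i, v i = s ∨ ∑ i, v i = s + 1) ∧ ∀ i, v i ≤ s - δ

open Finset in
theorem Finset.card_piAntidiag_nat {ι : Type*} [DecidableEq ι] (S : Finset ι) (n : ℕ) :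
    #(S.piAntidiag n) = (#S + n - 1).choose n := by
  rw [← card_finsuppAntidiag_nat_eq_choose, finsuppAntidiag, card_map, card_attach]

open Finset in
/-- The number of compositions of `n + 1` with support exactly `S`. -/
theorem card_piAntidiag_filter_support_eq {ι : Type*} [Fintype ι] [DecidableEq ι]
    (S : Finset ι) {l : ℕ} (hS : #S = l + 1) (n : ℕ) :
    #{w ∈ piAntidiag (univ : Finset ι) (n + 1) | ({i | 0 < w i} : Finset ι) = S} =
      n.choose l := by
  obtain hn | hn := lt_or_ge n l
  · rw [Nat.choose_eq_zero_of_lt hn, card_eq_zero, filter_eq_empty_iff]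
    rintro w hw rfl
    have h1 : ∑ i, w i = n + 1 := (mem_piAntidiag.1 hw).1
    have h2 : #({i | 0 < w i} : Finset ι) ≤ ∑ i, w i := by
      rw [card_filter]
      exact sum_le_sum fun i _ => by split_ifs <;> omega
    omega
  · have hcard : n.choose l = #(S.piAntidiag (n - l)) := by
      rw [card_piAntidiag_nat, hS, show l + 1 + (n - l) - 1 = n by omega, Nat.choose_symm hn]
    rw [hcard]
    refine card_nbij' (fun w i => w i - 1) (fun u i => if i ∈ S then u i + 1 else 0)
      ?_ ?_ ?_ ?_
    · rintro w hw
      simp only [coe_filter, Set.mem_ofPred_eq, mem_piAntidiag] at hw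
      obtain ⟨⟨hw, -⟩, hwS⟩ := hw
      have hmem (i : ι) : 0 < w i ↔ i ∈ S := by simpa using Finset.ext_iff.1 hwS i
      simp only [mem_coe, mem_piAntidiag]
      refine ⟨?_, fun i hi => (hmem i).1 (by omega)⟩
      have h1 : ∑ i ∈ S, w i = n + 1 := by
        rw [← hw]
        exact sum_subset (subset_univ _) fun i _ hi => Nat.eq_zero_of_not_pos (mt (hmem i).1 hi)
      have h2 : ∑ i ∈ S, w i = ∑ i ∈ S, (w i - 1) + ∑ i ∈ S, 1 := by
        rw [← sum_add_distrib]
        exact sum_congr rfl fun i hi => by have := (hmem i).2 hi; omega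
      rw [sum_const, smul_eq_mul, mul_one, hS] at h2
      omega
    · rintro u hu
      simp only [mem_coe, mem_piAntidiag] at hu
      simp only [coe_filter, Set.mem_ofPred_eq, mem_piAntidiag]
      refine ⟨⟨?_, by simp⟩, ?_⟩
      · rw [sum_ite_mem, univ_inter, sum_add_distrib, hu.1, sum_const, hS, smul_eq_mul]
        omega
      · ext i
        by_cases hi : i ∈ S <;> simp [hi]
    · rintro w hw
      simp only [coe_filter, Set.mem_ofPred_eq, mem_piAntidiag] at hw
      funext i
      have hmem : 0 < w i ↔ i ∈ S := by simpa using Finset.ext_iff.1 hw.2 i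
      dsimp only
      split_ifs with hi
      · have := hmem.2 hi
        omega
      · exact (Nat.eq_zero_of_not_pos (mt hmem.1 hi)).symm
    · rintro u hu
      simp only [mem_coe, mem_piAntidiag] at hu
      funext i
      have := hu.2 i
      dsimp only
      split_ifs with hi
      · rfl
      · by_contra h
        exact hi (this (by omega))

open Finset in
/-- The tuples of natural numbers indexed by `ι` with sum `n` and exactly `k` positive entries. -/
def tuplesWithPosCount (ι : Type*) [Fintype ι] [DecidableEq ι] (n k : ℕ) : Finset (ι → ℕ) :=
  {w ∈ piAntidiag univ n | #{i | 0 < w i} = k}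

open Finset in
theorem mem_tuplesWithPosCount {ι : Type*} [Fintype ι] [DecidableEq ι] {n k : ℕ} {w : ι → ℕ} :
    w ∈ tuplesWithPosCount ι n k ↔ ∑ i, w i = n ∧ #{i | 0 < w i} = k := by
  simp [tuplesWithPosCount]

open Finset in
theorem card_tuplesWithPosCount (ι : Type*) [Fintype ι] [DecidableEq ι] (n l : ℕ) :
    #(tuplesWithPosCount ι (n + 1) (l + 1)) =
      (Fintype.card ι).choose (l + 1) * n.choose l := by
  have hmaps : ∀ w ∈ tuplesWithPosCount ι (n + 1) (l + 1),
      ({i | 0 < w i} : Finset ι) ∈ powersetCard (l + 1) univ := fun w hw => by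
    simpa using (mem_tuplesWithPosCount.1 hw).2
  rw [card_eq_sum_card_fiberwise hmaps, sum_congr rfl fun S hS => ?_, sum_const,
    card_powersetCard, smul_eq_mul, card_univ]
  rw [← card_piAntidiag_filter_support_eq S (mem_powersetCard.1 hS).2 n]
  congr 1
  ext w
  simp only [mem_filter, tuplesWithPosCount, and_assoc]
  refine and_congr_right fun _ => ⟨fun h => h.2, fun h => ⟨?_, h⟩⟩
  rw [h]
  exact (mem_powersetCard.1 hS).2

open Finset in
/-- Subtracting `s - δ` at `j` identifies the tuples of sum `s + 1` that are large at `j` with the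
tuples of sum `δ + 1` that are positive at `j`. -/
theorem card_filter_lt_apply_tuplesWithPosCount {ι : Type*} [Fintype ι] [DecidableEq ι]
    {s δ : ℕ} (hδ : δ ≤ s) (k : ℕ) (j : ι) :
    #{w ∈ tuplesWithPosCount ι (s + 1) k | s - δ < w j} =
      #{w ∈ tuplesWithPosCount ι (δ + 1) k | 0 < w j} := by
  symm
  have hpos : ∀ w : ι → ℕ, 0 < w j →
      ({i | 0 < (w + Pi.single j (s - δ) : ι → ℕ) i} : Finset ι) =
        ({i | 0 < w i} : Finset ι) := fun w hw => by
    ext i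
    obtain rfl | hi := eq_or_ne i j
    · simp [hw]
    · simp [hi]
  refine card_bij (fun w _ => w + Pi.single j (s - δ)) ?_ ?_ ?_
  · intro w hw
    simp only [mem_filter, mem_tuplesWithPosCount] at hw ⊢
    rw [hpos w hw.2]
    refine ⟨⟨?_, hw.1.2⟩, by simpa using hw.2⟩
    simp only [Pi.add_apply, sum_add_distrib, hw.1.1, sum_pi_single', mem_univ, if_true]
    omega
  · intro w _ w' _ h
    exact add_right_cancel h
  · intro w hw
    simp only [mem_filter, mem_tuplesWithPosCount] at hw
    have hle : (Pi.single j (s - δ) : ι → ℕ) ≤ w := fun i => by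
      obtain rfl | hi := eq_or_ne i j
      · simpa using hw.2.le
      · simp [hi]
    obtain ⟨u, rfl⟩ := exists_add_of_le hle
    rw [add_comm] at hw
    have huj : 0 < u j := by simpa using hw.2
    refine ⟨u, ?_, add_comm _ _⟩
    rw [hpos u huj] at hw
    simp only [Pi.add_apply, sum_add_distrib, sum_pi_single', mem_univ, if_true] at hw
    simp only [mem_filter, mem_tuplesWithPosCount]
    exact ⟨⟨by omega, hw.1.2⟩, huj⟩

open Finset in
theorem sum_card_filter_pos_tuplesWithPosCount (ι : Type*) [Fintype ι] [DecidableEq ι]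
    (n k : ℕ) :
    ∑ j, #{w ∈ tuplesWithPosCount ι n k | 0 < w j} = k * #(tuplesWithPosCount ι n k) := by
  simp_rw [card_filter]
  rw [sum_comm, sum_congr rfl fun w hw => ?_, sum_const, smul_eq_mul, mul_comm]
  rw [← card_filter]
  exact (mem_tuplesWithPosCount.1 hw).2

open Finset in
/-- The members of `tuplesWithPosCount ι n k` all of whose entries are at most `m`. -/
def boundedTuplesWithPosCount (ι : Type*) [Fintype ι] [DecidableEq ι] (n k m : ℕ) :
    Finset (ι → ℕ) :=
  {w ∈ tuplesWithPosCount ι n k | ∀ i, w i ≤ m}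

open Finset in
theorem mem_boundedTuplesWithPosCount {ι : Type*} [Fintype ι] [DecidableEq ι] {n k m : ℕ}
    {w : ι → ℕ} : w ∈ boundedTuplesWithPosCount ι n k m ↔
      (∑ i, w i = n ∧ #{i | 0 < w i} = k) ∧ ∀ i, w i ≤ m := by
  rw [boundedTuplesWithPosCount, mem_filter, mem_tuplesWithPosCount]

open Finset in
/-- At most one entry exceeds `s - δ`, so the tuples with a large entry are counted by summing over
the position of that entry. -/
theorem card_boundedTuplesWithPosCount_add (ι : Type*) [Fintype ι] [DecidableEq ι]
    {s δ l : ℕ} (hδ : 2 * δ ≤ s) :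
    #(boundedTuplesWithPosCount ι (s + 1) (l + 1) (s - δ)) +
      (l + 1) * #(tuplesWithPosCount ι (δ + 1) (l + 1)) =
      #(tuplesWithPosCount ι (s + 1) (l + 1)) := by
  have hbad : #{w ∈ tuplesWithPosCount ι (s + 1) (l + 1) | ¬ ∀ i, w i ≤ s - δ} =
      (l + 1) * #(tuplesWithPosCount ι (δ + 1) (l + 1)) := by
    rw [← sum_card_filter_pos_tuplesWithPosCount, ← sum_congr rfl fun j _ =>
      card_filter_lt_apply_tuplesWithPosCount (by omega : δ ≤ s) (l + 1) j, ← card_biUnion]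
    · congr 1
      ext w
      simp
    · intro i _ j _ hij
      refine disjoint_left.2 fun w hi hj => ?_
      simp only [mem_filter, mem_tuplesWithPosCount] at hi hj
      have hpair : ∑ x ∈ {i, j}, w x ≤ ∑ x, w x := sum_le_sum_of_subset (subset_univ _)
      rw [sum_pair hij] at hpair
      omega
  rw [← hbad, boundedTuplesWithPosCount, card_filter_add_card_filter_not]

open Finset in
theorem sum_natAbs_sub_eq_one_iff {ι : Type*} [Fintype ι] [DecidableEq ι] {v w : ι → ℕ}
    (h : ∑ i, w i = ∑ i, v i + 1) :
    ∑ i, ((v i : ℤ) - w i).natAbs = 1 ↔ ∃ i, w = v + Pi.single i 1 := by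
  constructor
  · intro h1
    obtain ⟨i, -, hi⟩ := exists_ne_zero_of_sum_ne_zero (h1.trans_ne one_ne_zero)
    rw [← add_sum_erase _ _ (mem_univ i)] at h1
    have hne := sum_eq_zero_iff.1
      (by omega : ∑ j ∈ univ.erase i, ((v j : ℤ) - w j).natAbs = 0)
    have hoff : ∀ j ≠ i, w j = v j := fun j hj => by
      have := hne j (mem_erase.2 ⟨hj, mem_univ j⟩)
      omega
    have hrest : ∑ j ∈ univ.erase i, w j = ∑ j ∈ univ.erase i, v j :=
      sum_congr rfl fun j hj => hoff j (ne_of_mem_erase hj)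
    rw [← add_sum_erase _ _ (mem_univ i), ← add_sum_erase _ v (mem_univ i), hrest] at h
    refine ⟨i, funext fun j => ?_⟩
    obtain rfl | hj := eq_or_ne j i
    · simp only [Pi.add_apply, Pi.single_eq_same]
      omega
    · simp [hj, hoff j hj]
  · rintro ⟨i, rfl⟩
    rw [sum_eq_single i (fun j _ hj => by simp [hj]) (by simp)]
    simp

open Finset in
/-- An edge is determined by its upper endpoint `w` and a positive coordinate to be lowered. -/
theorem natCard_edges_eq (d s δ l : ℕ) :
    Nat.card {p : (Fin (d + 1) → ℕ) × (Fin (d + 1) → ℕ) //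
        inSimplifiedV d s δ p.1 ∧ inSimplifiedV d s δ p.2 ∧
        (∑ i, p.1 i = s) ∧ (∑ i, p.2 i = s + 1) ∧
        (∑ i, ((p.1 i : ℤ) - p.2 i).natAbs = 1) ∧
        (Finset.univ.filter fun i => 0 < p.2 i).card = l + 1} =
      (l + 1) *
        #(boundedTuplesWithPosCount (Fin (d + 1)) (s + 1) (l + 1) (s - δ)) := by
  set G := boundedTuplesWithPosCount (Fin (d + 1)) (s + 1) (l + 1) (s - δ)
  have hsigma : #(G.sigma fun w => ({i | 0 < w i} : Finset (Fin (d + 1)))) = (l + 1) * #G := by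
    rw [card_sigma, sum_congr rfl fun w hw => (mem_boundedTuplesWithPosCount.1 hw).1.2,
      sum_const, smul_eq_mul, mul_comm]
  have hback : ∀ (w : Fin (d + 1) → ℕ) i, 0 < w i → w - Pi.single i 1 + Pi.single i 1 = w :=
    fun w i hi => tsub_add_cancel_of_le fun j => by
      obtain rfl | hj := eq_or_ne j i
      · simpa [Nat.one_le_iff_ne_zero, Nat.pos_iff_ne_zero] using hi
      · simp [hj]
  have hinj : Set.InjOn
      (fun e : (_ : Fin (d + 1) → ℕ) × Fin (d + 1) => (e.1 - Pi.single e.2 1, e.1))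
      (G.sigma fun w => ({i | 0 < w i} : Finset (Fin (d + 1)))) := by
    rintro ⟨w, i⟩ hi ⟨w', j⟩ hj h
    obtain ⟨h, rfl⟩ := Prod.mk.inj h
    simp only [mem_coe, mem_sigma, mem_filter, mem_univ, true_and] at hi hj
    by_contra hij
    have hne : i ≠ j := fun e => hij (by rw [e])
    have := congrFun h i
    simp only [Pi.sub_apply, Pi.single_eq_same, Pi.single_eq_of_ne hne] at this
    omega
  rw [← hsigma, ← card_image_of_injOn hinj]
  refine Nat.subtype_card _ fun ⟨v, w⟩ => ?_
  simp only [G, mem_image, mem_sigma, mem_filter, mem_univ, true_and,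
    mem_boundedTuplesWithPosCount, Sigma.exists, Prod.mk.injEq]
  constructor
  · rintro ⟨w, i, ⟨⟨⟨hsum, hcard⟩, hle⟩, hi⟩, rfl, rfl⟩
    have hstep := hback w i hi
    set v := w - Pi.single i 1
    have hsum' : ∑ j, w j = ∑ j, v j + 1 := by
      rw [← hstep]
      simp [sum_add_distrib]
    have hv : ∑ j, v j = s := by omega
    refine ⟨⟨.inl hv, fun j => tsub_le_self.trans (hle j)⟩, ⟨.inr hsum, hle⟩, hv, hsum,
      (sum_natAbs_sub_eq_one_iff hsum').2 ⟨i, hstep.symm⟩, hcard⟩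
  · rintro ⟨-, ⟨-, hle⟩, hv, hw, hdist, hcard⟩
    obtain ⟨i, rfl⟩ := (sum_natAbs_sub_eq_one_iff (by rw [hv, hw])).1 hdist
    exact ⟨_, i, ⟨⟨⟨hw, hcard⟩, hle⟩, by simp⟩, add_tsub_cancel_right _ _, rfl⟩

/-- Let `2δ ≤ s` and `1 ≤ l ≤ d`. The number of edges `e ∈ E_{d,s,δ}` with
`level_d(e) = l` equals `(d+1) · C(d, l) · ( C(s, l) − (l+1)·C(δ, l) )`.
Every such edge joins a point `v` of `△_{d,s}^ℤ ∩ V_{d,s,δ}` to a point `w` of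
`△_{d,s+1}^ℤ ∩ V_{d,s,δ}` at `L¹`-distance 1, and its level
`max(level v, level w) = level w` equals `l` iff the support of `w` has size `l+1`;
edges are counted as such ordered pairs `(v, w)`. -/
theorem simplified_simplex_edge_count_E (d s δ l : ℕ) (hδ : 2 * δ ≤ s)
    (hl1 : 1 ≤ l) (hld : l ≤ d) :
    (Nat.card {p : (Fin (d + 1) → ℕ) × (Fin (d + 1) → ℕ) //
        inSimplifiedV d s δ p.1 ∧ inSimplifiedV d s δ p.2 ∧
        (∑ i, p.1 i = s) ∧ (∑ i, p.2 i = s + 1) ∧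
        (∑ i, ((p.1 i : ℤ) - p.2 i).natAbs = 1) ∧
        (Finset.univ.filter fun i => 0 < p.2 i).card = l + 1} : ℤ) =
      (d + 1) * (d.choose l : ℤ) * ((s.choose l : ℤ) - (l + 1) * (δ.choose l : ℤ)) := by
  have hgood := card_boundedTuplesWithPosCount_add (Fin (d + 1)) (l := l) hδ
  rw [card_tuplesWithPosCount, card_tuplesWithPosCount, Fintype.card_fin] at hgood
  have hchoose := Nat.add_one_mul_choose_eq d l
  rw [natCard_edges_eq]
  zify at hgood hchoose
  push_cast
  linear_combination (l + 1 : ℤ) * hgood -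
    ((s.choose l : ℤ) - (l + 1) * (δ.choose l : ℤ)) * hchoose
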